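/- arXiv:2506.15982 — 9 statements merged into one kernel-verified Lean document; each statement's English description precedes it below -/
import Mathlib

section
/- If 0 < β < 1, 0 < r < 1, α > 0 and α < β + r, then every complex eigenvalue λ of the matrix J₁ (viewed as a matrix over ℂ) satisfies |λ| < 1; hence the disease-free fixed point E₁ is a stable (hyperbolic attracting) node of the SIR map. -/
theorem sirE1_stable_node (α β r : ℝ)
    (hβ0 : 0 < β) (hβ1 : β < 1) (hr0 : 0 < r) (hr1 : r < 1)
    (hα0 : 0 < α) (hα : α < β + r) :
    ∀ lam : ℂ,
      lam ∈ spectrum ℂ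
        ((!![1 - β, -α, 0;
             0, 1 - β - r + α, 0;
             0, r, 1 - β] : Matrix (Fin 3) (Fin 3) ℝ).map (algebraMap ℝ ℂ)) →
      ‖lam‖ < 1 := by
  intro lam h
  rw [spectrum.mem_iff, Matrix.isUnit_iff_isUnit_det, isUnit_iff_ne_zero, not_not,
    Matrix.det_fin_three] at h
  simp [Matrix.algebraMap_matrix_apply] at h
  have key : (lam - ((1 - β : ℝ) : ℂ)) * (lam - ((1 - β : ℝ) : ℂ))
      * (lam - ((1 - β - r + α : ℝ) : ℂ)) = 0 := by
    push_cast
    first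
      | linear_combination h
      | (rcases h with h | h
         · rcases h with h | h <;> simp [h]
         · simp [h])
  have h1 : ‖((1 - β : ℝ) : ℂ)‖ < 1 := by
    rw [Complex.norm_real, Real.norm_eq_abs, abs_lt]
    constructor <;> linarith
  have h2 : ‖((1 - β - r + α : ℝ) : ℂ)‖ < 1 := by
    rw [Complex.norm_real, Real.norm_eq_abs, abs_lt]
    constructor <;> linarith
  rcases mul_eq_zero.mp key with h | h
  · rw [sub_eq_zero.mp (mul_self_eq_zero.mp h)]; exact h1
  · rw [sub_eq_zero.mp h]; exact h2
end

section
/- If 0 < β < 1, 0 < r < 1 and β + r < α ≤ Υ₁ := 2(β² + 2rβ + r² − √(rβ³ + 3r²β² + 3r³β + r⁴))/β, then Δ ≥ 0, the quadratic t² − b·t − c has two real roots, and every real root t of this quadratic satisfies −1 < t < 1; together with the eigenvalue 1−β ∈ (0,1) of the Jacobian, the endemic fixed point E₂ is a stable node. -/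
theorem sirE2_stable_node (α β r : ℝ)
    (hβ0 : 0 < β) (hβ1 : β < 1) (hr0 : 0 < r) (hr1 : r < 1)
    (hα1 : β + r < α)
    (hα2 : α ≤ 2 * (β ^ 2 + 2 * r * β + r ^ 2
        - Real.sqrt (r * β ^ 3 + 3 * r ^ 2 * β ^ 2 + 3 * r ^ 3 * β + r ^ 4)) / β) :
    (0 ≤ α ^ 2 * β ^ 2 - 4 * α * β ^ 3 - 8 * α * β ^ 2 * r - 4 * α * β * r ^ 2
        + 4 * β ^ 4 + 12 * β ^ 3 * r + 12 * β ^ 2 * r ^ 2 + 4 * β * r ^ 3) ∧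
    (∃ u v : ℝ,
      u ^ 2 - (((2 - α) * β + 2 * r) / (β + r)) * u
        - (β ^ 3 + (-α + 2 * r) * β ^ 2 + (r - 1) * (r - α + 1) * β - r) / (β + r) = 0 ∧
      v ^ 2 - (((2 - α) * β + 2 * r) / (β + r)) * v
        - (β ^ 3 + (-α + 2 * r) * β ^ 2 + (r - 1) * (r - α + 1) * β - r) / (β + r) = 0) ∧
    (∀ t : ℝ,
      t ^ 2 - (((2 - α) * β + 2 * r) / (β + r)) * t
        - (β ^ 3 + (-α + 2 * r) * β ^ 2 + (r - 1) * (r - α + 1) * β - r) / (β + r) = 0 →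
      -1 < t ∧ t < 1) := by
  set S := Real.sqrt (r * β ^ 3 + 3 * r ^ 2 * β ^ 2 + 3 * r ^ 3 * β + r ^ 4) with hS
  have hS0 : 0 ≤ S := Real.sqrt_nonneg _
  have hSq : S ^ 2 = r * (β + r) ^ 3 := by
    rw [hS, Real.sq_sqrt (by positivity)]; ring
  have hs : 0 < β + r := by positivity
  rw [le_div_iff₀ hβ0] at hα2
  have hSr : r * (β + r) ≤ S := by
    refine abs_le_of_sq_le_sq' ?_ hS0 |>.2
    rw [hSq]
    have : 0 ≤ r * (β + r) ^ 2 * β := by positivity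
    nlinarith
  have hα3 : α ≤ 2 * (β + r) := by
    have : α * β ≤ (2 * (β + r)) * β := by nlinarith
    exact le_of_mul_le_mul_right this hβ0
  have hΔ : 0 ≤ α ^ 2 * β ^ 2 - 4 * α * β ^ 3 - 8 * α * β ^ 2 * r - 4 * α * β * r ^ 2
        + 4 * β ^ 4 + 12 * β ^ 3 * r + 12 * β ^ 2 * r ^ 2 + 4 * β * r ^ 3 := by
    have h1 : 2 * S ≤ 2 * (β + r) ^ 2 - α * β := by nlinarith
    have h2 : (2 * S) ^ 2 ≤ (2 * (β + r) ^ 2 - α * β) ^ 2 := by gcongr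
    rw [mul_pow, hSq] at h2
    linarith
  have key : ∀ t : ℝ, t ^ 2 - (((2 - α) * β + 2 * r) / (β + r)) * t
        - (β ^ 3 + (-α + 2 * r) * β ^ 2 + (r - 1) * (r - α + 1) * β - r) / (β + r)
        = ((β + r) * (1 - t) ^ 2 - α * β * (1 - t) + β * (β + r) * (α - (β + r))) / (β + r) := by
    intro t
    field_simp
    ring
  refine ⟨hΔ, ?_, ?_⟩
  · set D := α ^ 2 * β ^ 2 - 4 * α * β ^ 3 - 8 * α * β ^ 2 * r - 4 * α * β * r ^ 2
        + 4 * β ^ 4 + 12 * β ^ 3 * r + 12 * β ^ 2 * r ^ 2 + 4 * β * r ^ 3 with hD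
    have hq := Real.sq_sqrt hΔ
    refine ⟨1 - (α * β + Real.sqrt D) / (2 * (β + r)),
      1 - (α * β - Real.sqrt D) / (2 * (β + r)), ?_, ?_⟩
    all_goals
      rw [key]
      generalize Real.sqrt D = d at hq
      rw [hD] at hq
      field_simp
      linarith
  · intro t ht
    rw [key, div_eq_zero_iff] at ht
    have ht := ht.resolve_right hs.ne'
    have hα0 : 0 < α := hs.trans hα1
    have hk : 0 < β * (β + r) * (α - (β + r)) :=
      mul_pos (mul_pos hβ0 hs) (sub_pos.2 hα1)
    constructor
    · by_contra h
      have hw : 2 ≤ 1 - t := by linarith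
      have h1 : α * β ≤ 2 * (β + r) := by nlinarith
      have h2 : 0 ≤ (1 - t) * ((β + r) * (1 - t) - α * β) :=
        mul_nonneg (by linarith) (by nlinarith)
      nlinarith
    · by_contra h
      have hw : 0 ≤ t - 1 := by linarith
      have h1 : 0 ≤ α * β * (t - 1) := by positivity
      have h2 : 0 ≤ (β + r) * (1 - t) ^ 2 := by positivity
      linarith
end

section
/- If 0 < β < 1, Ψ₁ < r < 1 and Υ₁ < α < Ψ₃, where Ψ₁ := (β² − 4β + 4)/(4 − β), Υ₁ := 2(β² + 2rβ + r² − √(rβ³ + 3r²β² + 3r³β + r⁴))/β and Ψ₃ := (β² + 2rβ + r²)/(r + β − 1), then Δ < 0 and every complex root z of the quadratic t² − b·t − c has nonzero imaginary part and satisfies |z| < 1; hence the endemic fixed point E₂ is a stable focus-node. -/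
theorem sirE2_stable_focus_node (α β r : ℝ)
    (hβ0 : 0 < β) (hβ1 : β < 1)
    (hr0 : (β ^ 2 - 4 * β + 4) / (4 - β) < r) (hr1 : r < 1)
    (hα1 : 2 * (β ^ 2 + 2 * r * β + r ^ 2
        - Real.sqrt (r * β ^ 3 + 3 * r ^ 2 * β ^ 2 + 3 * r ^ 3 * β + r ^ 4)) / β < α)
    (hα2 : α < (β ^ 2 + 2 * r * β + r ^ 2) / (r + β - 1)) :
    (α ^ 2 * β ^ 2 - 4 * α * β ^ 3 - 8 * α * β ^ 2 * r - 4 * α * β * r ^ 2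
        + 4 * β ^ 4 + 12 * β ^ 3 * r + 12 * β ^ 2 * r ^ 2 + 4 * β * r ^ 3 < 0) ∧
    (∀ z : ℂ,
      z ^ 2 - (((((2 - α) * β + 2 * r) / (β + r) : ℝ)) : ℂ) * z
        - ((((β ^ 3 + (-α + 2 * r) * β ^ 2 + (r - 1) * (r - α + 1) * β - r) / (β + r) : ℝ)) : ℂ)
        = 0 →
      z.im ≠ 0 ∧ ‖z‖ < 1) := by
  have h4 : 0 < 4 - β := by linarith
  rw [div_lt_iff₀ h4] at hr0
  have hs1 : 0 < r + β - 1 := by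
    by_contra h
    push Not at h
    nlinarith
  have hr : 0 < r := by linarith
  rw [lt_div_iff₀ hs1] at hα2
  rw [div_lt_iff₀ hβ0] at hα1
  have hs : 0 < β + r := by linarith
  have hQ : 0 ≤ r * β ^ 3 + 3 * r ^ 2 * β ^ 2 + 3 * r ^ 3 * β + r ^ 4 := by positivity
  have hq2 := Real.sq_sqrt hQ
  have hq0 := Real.sqrt_nonneg (r * β ^ 3 + 3 * r ^ 2 * β ^ 2 + 3 * r ^ 3 * β + r ^ 4)
  set q := Real.sqrt (r * β ^ 3 + 3 * r ^ 2 * β ^ 2 + 3 * r ^ 3 * β + r ^ 4) with hq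
  -- upper bound
  have hup : α * β - 2 * (β + r) ^ 2 < 2 * q := by
    have h1 : (β - 2 * (r + β - 1)) * (β + r) ^ 2 ≤ 2 * q * (r + β - 1) := by
      refine abs_le_of_sq_le_sq' ?_ ?_ |>.2
      · have e : (2 * q * (r + β - 1)) ^ 2 - ((β - 2 * (r + β - 1)) * (β + r) ^ 2) ^ 2
            = (β + r) ^ 3 * β * ((4 - β) * (β + r) - 4) := by
          have : (2 * q * (r + β - 1)) ^ 2 = 4 * (q ^ 2) * (r + β - 1) ^ 2 := by ring
          rw [this, hq2]; ring
        have : 0 ≤ (β + r) ^ 3 * β * ((4 - β) * (β + r) - 4) := by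
          have : 0 ≤ (4 - β) * (β + r) - 4 := by nlinarith
          positivity
        linarith
      · positivity
    have h2 : (α * β - 2 * (β + r) ^ 2) * (r + β - 1) < 2 * q * (r + β - 1) := by
      nlinarith [mul_lt_mul_of_pos_left hα2 hβ0]
    exact lt_of_mul_lt_mul_right h2 hs1.le
  have hlo : -(2 * q) < α * β - 2 * (β + r) ^ 2 := by nlinarith
  have hD : α ^ 2 * β ^ 2 - 4 * α * β ^ 3 - 8 * α * β ^ 2 * r - 4 * α * β * r ^ 2
        + 4 * β ^ 4 + 12 * β ^ 3 * r + 12 * β ^ 2 * r ^ 2 + 4 * β * r ^ 3 < 0 := by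
    have h := sq_lt_sq' hlo hup
    have : (2 * q) ^ 2 = 4 * q ^ 2 := by ring
    rw [this, hq2] at h
    linarith
  refine ⟨hD, ?_⟩
  intro z hz
  have hdisc : (((2 - α) * β + 2 * r) / (β + r)) ^ 2 + 4 * ((β ^ 3 + (-α + 2 * r) * β ^ 2
      + (r - 1) * (r - α + 1) * β - r) / (β + r)) < 0 := by
    have e : (((2 - α) * β + 2 * r) / (β + r)) ^ 2 + 4 * ((β ^ 3 + (-α + 2 * r) * β ^ 2
      + (r - 1) * (r - α + 1) * β - r) / (β + r)) =
      (α ^ 2 * β ^ 2 - 4 * α * β ^ 3 - 8 * α * β ^ 2 * r - 4 * α * β * r ^ 2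
        + 4 * β ^ 4 + 12 * β ^ 3 * r + 12 * β ^ 2 * r ^ 2 + 4 * β * r ^ 3) / (β + r) ^ 2 := by
      field_simp
      ring
    rw [e]
    exact div_neg_of_neg_of_pos hD (by positivity)
  have hc : -1 < (β ^ 3 + (-α + 2 * r) * β ^ 2
      + (r - 1) * (r - α + 1) * β - r) / (β + r) := by
    rw [lt_div_iff₀ hs]
    nlinarith [mul_lt_mul_of_pos_left hα2 hβ0]
  generalize ((2 - α) * β + 2 * r) / (β + r) = b at *
  generalize (β ^ 3 + (-α + 2 * r) * β ^ 2 + (r - 1) * (r - α + 1) * β - r) / (β + r) = c at *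
  have hre := congrArg Complex.re hz
  have him := congrArg Complex.im hz
  simp [pow_two] at hre him
  have hy : z.im ≠ 0 := by
    intro h
    rw [h] at hre
    nlinarith [sq_nonneg (2 * z.re - b)]
  refine ⟨hy, ?_⟩
  have hx : 2 * z.re - b = 0 := by
    apply (mul_eq_zero.mp (?_ : (2 * z.re - b) * z.im = 0)).resolve_right hy
    linarith
  have hb : b = 2 * z.re := by linarith
  rw [hb] at hre
  have hn : ‖z‖ ^ 2 < 1 ^ 2 := by
    rw [Complex.sq_norm, Complex.normSq_apply]
    linarith
  exact lt_of_pow_lt_pow_left₀ 2 (by norm_num) hn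
end

section
/- If 0 < β < 1, Ψ₁ < r < 1 and Ψ₃ < α < Υ₂, where Ψ₁ := (β² − 4β + 4)/(4 − β), Ψ₃ := (β² + 2rβ + r²)/(r + β − 1) and Υ₂ := 2(β² + 2rβ + r² + √(rβ³ + 3r²β² + 3r³β + r⁴))/β, then Δ < 0 and every complex root z of the quadratic t² − b·t − c has nonzero imaginary part and satisfies |z| > 1; hence (since 0 < 1−β < 1) the endemic fixed point E₂ is a saddle-focus. -/
theorem sirE2_saddle_focus (α β r : ℝ)
    (hβ0 : 0 < β) (hβ1 : β < 1)
    (hr0 : (β ^ 2 - 4 * β + 4) / (4 - β) < r) (hr1 : r < 1)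
    (hα1 : (β ^ 2 + 2 * r * β + r ^ 2) / (r + β - 1) < α)
    (hα2 : α < 2 * (β ^ 2 + 2 * r * β + r ^ 2
        + Real.sqrt (r * β ^ 3 + 3 * r ^ 2 * β ^ 2 + 3 * r ^ 3 * β + r ^ 4)) / β) :
    (α ^ 2 * β ^ 2 - 4 * α * β ^ 3 - 8 * α * β ^ 2 * r - 4 * α * β * r ^ 2
        + 4 * β ^ 4 + 12 * β ^ 3 * r + 12 * β ^ 2 * r ^ 2 + 4 * β * r ^ 3 < 0) ∧
    (∀ z : ℂ,
      z ^ 2 - (((((2 - α) * β + 2 * r) / (β + r) : ℝ)) : ℂ) * z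
        - ((((β ^ 3 + (-α + 2 * r) * β ^ 2 + (r - 1) * (r - α + 1) * β - r) / (β + r) : ℝ)) : ℂ)
        = 0 →
      z.im ≠ 0 ∧ 1 < ‖z‖) := by
  have h4 : 0 < 4 - β := by linarith
  rw [div_lt_iff₀ h4] at hr0
  obtain ⟨s, hs⟩ : ∃ s, s = β + r := ⟨_, rfl⟩
  have hr : r = s - β := by linarith
  have hs1 : 0 < s - 1 := by
    have : 0 < (s - 1) * (4 - β) := by rw [hs]; nlinarith
    exact pos_of_mul_pos_left this h4.le
  have hs2 : s < 2 := by linarith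
  have hrpos : 0 < r := by linarith
  have hs0 : 0 < s := by linarith
  have e1 : r + β - 1 = s - 1 := by rw [hs]; ring
  rw [e1, div_lt_iff₀ hs1] at hα1
  have e2 : β ^ 2 + 2 * r * β + r ^ 2 = s ^ 2 := by rw [hs]; ring
  have e3 : r * β ^ 3 + 3 * r ^ 2 * β ^ 2 + 3 * r ^ 3 * β + r ^ 4 = r * s ^ 3 := by rw [hs]; ring
  rw [e2] at hα1
  rw [e2, e3, lt_div_iff₀ hβ0] at hα2
  have hS2 : Real.sqrt (r * s ^ 3) ^ 2 = r * s ^ 3 := Real.sq_sqrt (by positivity)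
  have hS0 := Real.sqrt_nonneg (r * s ^ 3)
  generalize Real.sqrt (r * s ^ 3) = S at *
  have hαpos : 0 < α := by
    have : 0 < α * (s - 1) := lt_trans (by positivity) hα1
    exact pos_of_mul_pos_left this hs1.le
  have hlow : 0 < α * β - 2 * (s ^ 2 - S) := by
    have hp : 0 < s ^ 2 + S := by positivity
    have k1 : 2 * s ^ 3 < α * (s ^ 2 + S) := by
      have a1 : 0 < s * (α * (s - 1) - s ^ 2) := mul_pos hs0 (by linarith)
      have a2 : 0 < α * s * (2 - s) := mul_pos (mul_pos hαpos hs0) (by linarith)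
      have a3 : 0 ≤ α * S := by positivity
      nlinarith
    have k2 : 0 < (α * β - 2 * (s ^ 2 - S)) * (s ^ 2 + S) := by
      have : (α * β - 2 * (s ^ 2 - S)) * (s ^ 2 + S)
          = β * (α * (s ^ 2 + S) - 2 * s ^ 3) := by
        rw [hr] at hS2
        linear_combination 2 * hS2
      rw [this]
      exact mul_pos hβ0 (by linarith)
    exact pos_of_mul_pos_left k2 hp.le
  have hD : α ^ 2 * β ^ 2 - 4 * α * β * s ^ 2 + 4 * β * s ^ 3 < 0 := by
    have := mul_pos hlow (sub_pos.2 hα2)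
    rw [hr] at hS2
    nlinarith
  refine ⟨by rw [hs] at hD; linarith, ?_⟩
  intro z hz
  have eb : ((2 - α) * β + 2 * r) / (β + r) = 2 - α * β / s := by
    rw [← hs]; field_simp; rw [hs]; ring
  have ec : (β ^ 3 + (-α + 2 * r) * β ^ 2 + (r - 1) * (r - α + 1) * β - r) / (β + r)
      = -1 - (α * (s - 1) - s ^ 2) * β / s := by
    rw [← hs]; field_simp; rw [hs]; ring
  rw [eb, ec] at hz
  have hu : 0 < (α * (s - 1) - s ^ 2) * β / s :=
    div_pos (mul_pos (by linarith) hβ0) hs0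
  have hdisc : (2 - α * β / s) ^ 2 + 4 * (-1 - (α * (s - 1) - s ^ 2) * β / s) < 0 := by
    have : (2 - α * β / s) ^ 2 + 4 * (-1 - (α * (s - 1) - s ^ 2) * β / s)
        = (α ^ 2 * β ^ 2 - 4 * α * β * s ^ 2 + 4 * β * s ^ 3) / s ^ 2 := by
      field_simp; ring
    rw [this]
    exact div_neg_of_neg_of_pos hD (by positivity)
  generalize 2 - α * β / s = b at *
  generalize (α * (s - 1) - s ^ 2) * β / s = u at *
  have hre := congrArg Complex.re hz
  have him := congrArg Complex.im hz
  simp only [pow_two, Complex.sub_re, Complex.sub_im, Complex.mul_re, Complex.mul_im,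
    Complex.ofReal_re, Complex.ofReal_im, Complex.zero_re, Complex.zero_im] at hre him
  have hne : z.im ≠ 0 := by
    intro h
    rw [h] at hre
    nlinarith [sq_nonneg (2 * z.re - b)]
  refine ⟨hne, ?_⟩
  have hb : b = 2 * z.re := by
    apply mul_right_cancel₀ hne
    linarith
  have hn : ‖z‖ ^ 2 = 1 + u := by
    rw [Complex.sq_norm, Complex.normSq_apply]
    rw [hb] at hre
    linarith
  nlinarith [norm_nonneg z]
end

section
/- If 0 < β < 1, 0 < r < 1 and α > Ψ₂ := (β³ + 2rβ² + r²β − 4β − 4r)/(β(r + β − 2)), then the quadratic t² − b·t − c has two real roots u < v with u < −1 < v < 1; hence (since 0 < 1−β < 1) the endemic fixed point E₂ is a saddle point. -/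
theorem quad_aux (b c : ℝ) (h1 : 1 + b - c < 0) (h2 : 0 < 1 - b - c) :
    ∃ u v : ℝ, u ^ 2 - b * u - c = 0 ∧ v ^ 2 - b * v - c = 0 ∧
      u < v ∧ u < -1 ∧ -1 < v ∧ v < 1 := by
  have hD : (b + 2) ^ 2 < b ^ 2 + 4 * c := by nlinarith
  have hD2 : b ^ 2 + 4 * c < (2 - b) ^ 2 := by nlinarith
  have hD0 : 0 ≤ b ^ 2 + 4 * c := (sq_nonneg _).trans hD.le
  have hsq := Real.sq_sqrt hD0
  have hn := Real.sqrt_nonneg (b ^ 2 + 4 * c)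
  set s := Real.sqrt (b ^ 2 + 4 * c)
  rw [← hsq] at hD hD2
  have h3 := abs_lt.1 (abs_lt_of_sq_lt_sq hD hn)
  have h4 : s < 2 - b := lt_of_pow_lt_pow_left₀ 2 (by linarith) hD2
  refine ⟨(b - s) / 2, (b + s) / 2, ?_, ?_, ?_, ?_, ?_, ?_⟩
  · nlinarith
  · nlinarith
  all_goals linarith [h3.1, h3.2]

theorem sirE2_saddle (α β r : ℝ)
    (hβ0 : 0 < β) (hβ1 : β < 1) (hr0 : 0 < r) (hr1 : r < 1)
    (hα : (β ^ 3 + 2 * r * β ^ 2 + r ^ 2 * β - 4 * β - 4 * r) / (β * (r + β - 2)) < α) :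
    ∃ u v : ℝ,
      u ^ 2 - (((2 - α) * β + 2 * r) / (β + r)) * u
        - (β ^ 3 + (-α + 2 * r) * β ^ 2 + (r - 1) * (r - α + 1) * β - r) / (β + r) = 0 ∧
      v ^ 2 - (((2 - α) * β + 2 * r) / (β + r)) * v
        - (β ^ 3 + (-α + 2 * r) * β ^ 2 + (r - 1) * (r - α + 1) * β - r) / (β + r) = 0 ∧
      u < v ∧ u < -1 ∧ -1 < v ∧ v < 1 := by
  have hs : 0 < β + r := by linarith
  have hd : β * (r + β - 2) < 0 := mul_neg_of_pos_of_neg hβ0 (by linarith)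
  rw [div_lt_iff_of_neg hd] at hα
  have hαs : β + r < α := by
    by_contra hcon
    have h1 := mul_nonneg_of_nonpos_of_nonpos hd.le (sub_nonpos.2 (not_lt.1 hcon))
    have h2 : 0 < (β + r) * (4 - 2 * β) := mul_pos hs (by linarith)
    nlinarith
  apply quad_aux
  · have h : 1 + (((2 - α) * β + 2 * r) / (β + r))
        - (β ^ 3 + (-α + 2 * r) * β ^ 2 + (r - 1) * (r - α + 1) * β - r) / (β + r)
        = (α * (β * (r + β - 2)) -
          (β ^ 3 + 2 * r * β ^ 2 + r ^ 2 * β - 4 * β - 4 * r)) / (β + r) := by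
      field_simp
      ring
    rw [h]
    exact div_neg_of_neg_of_pos (by linarith) hs
  · have h : 1 - (((2 - α) * β + 2 * r) / (β + r))
        - (β ^ 3 + (-α + 2 * r) * β ^ 2 + (r - 1) * (r - α + 1) * β - r) / (β + r)
        = β * (α - (β + r)) := by
      field_simp
      ring
    rw [h]
    exact mul_pos hβ0 (by linarith)
end

section
/- If 0 < β < 1, Ψ₁ < r < 1 (with Ψ₁ := (β² − 4β + 4)/(4 − β)) and α = Ψ₃ := (β² + 2rβ + r²)/(r + β − 1), then D := −β(β² + (r−4)β − 4r + 4)(β + r) > 0, 2β + 2r − 2 > 0, and the complex number t₁ := ((−β² − βr + 2β + 2r − 2) + i·√D)/(2β + 2r − 2) satisfies t₁² − b·t₁ − c = 0, |t₁| = 1, and Im t₁ ≠ 0; i.e. at the Neimark–Sacker critical parameter the Jacobian at E₂ has a nonreal pair of eigenvalues on the unit circle. -/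
theorem sirE2_NS_critical_eigenvalues (α β r : ℝ)
    (hβ0 : 0 < β) (hβ1 : β < 1)
    (hr0 : (β ^ 2 - 4 * β + 4) / (4 - β) < r) (hr1 : r < 1)
    (hα : α = (β ^ 2 + 2 * r * β + r ^ 2) / (r + β - 1)) :
    0 < -β * (β ^ 2 + (r - 4) * β - 4 * r + 4) * (β + r) ∧
    0 < 2 * β + 2 * r - 2 ∧
    (let t₁ : ℂ :=
        (((-β ^ 2 - β * r + 2 * β + 2 * r - 2 : ℝ) : ℂ)
          + (Real.sqrt (-β * (β ^ 2 + (r - 4) * β - 4 * r + 4) * (β + r)) : ℂ) * Complex.I)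
        / ((2 * β + 2 * r - 2 : ℝ) : ℂ)
     t₁ ^ 2 - (((((2 - α) * β + 2 * r) / (β + r) : ℝ)) : ℂ) * t₁
        - ((((β ^ 3 + (-α + 2 * r) * β ^ 2 + (r - 1) * (r - α + 1) * β - r) / (β + r) : ℝ)) : ℂ)
        = 0 ∧
      ‖t₁‖ = 1 ∧ t₁.im ≠ 0) := by
  have h4 : 0 < 4 - β := by linarith
  rw [div_lt_iff₀ h4] at hr0
  have hr : 0 < r := by
    have h1 : 0 < r * (4 - β) := by nlinarith [sq_nonneg (2 - β)]
    exact pos_of_mul_pos_left h1 h4.le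
  have hu : 0 < β + r := by linarith
  have hk : 0 < -(β ^ 2 + (r - 4) * β - 4 * r + 4) := by nlinarith
  have hs : 0 < r + β - 1 := by nlinarith [mul_pos hβ0 hu]
  have hD : 0 < -β * (β ^ 2 + (r - 4) * β - 4 * r + 4) * (β + r) := by
    have := mul_pos (mul_pos hβ0 hk) hu
    linarith
  have hs2 : 0 < 2 * β + 2 * r - 2 := by linarith
  refine ⟨hD, hs2, ?_⟩
  have hc : (β ^ 3 + (-α + 2 * r) * β ^ 2 + (r - 1) * (r - α + 1) * β - r) / (β + r) = -1 := by
    rw [div_eq_iff hu.ne']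
    have : α * (r + β - 1) = β ^ 2 + 2 * r * β + r ^ 2 := by
      rw [hα]; exact div_mul_cancel₀ _ hs.ne'
    linear_combination (-β) * this
  have hb : ((2 - α) * β + 2 * r) / (β + r)
      = 2 * ((-β ^ 2 - β * r + 2 * β + 2 * r - 2) / (2 * β + 2 * r - 2)) := by
    have : α * (r + β - 1) = β ^ 2 + 2 * r * β + r ^ 2 := by
      rw [hα]; exact div_mul_cancel₀ _ hs.ne'
    rw [← mul_div_assoc, div_eq_div_iff hu.ne' hs2.ne']
    linear_combination (-2 * β) * this
  have hS := Real.sq_sqrt hD.le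
  have hSp := Real.sqrt_pos.mpr hD
  rw [hb, hc]
  generalize Real.sqrt (-β * (β ^ 2 + (r - 4) * β - 4 * r + 4) * (β + r)) = S at hS hSp
  have hxy : ((-β ^ 2 - β * r + 2 * β + 2 * r - 2) / (2 * β + 2 * r - 2)) ^ 2
      + (S / (2 * β + 2 * r - 2)) ^ 2 = 1 := by
    rw [div_pow, div_pow, ← add_div, div_eq_one_iff_eq (pow_pos hs2 2).ne', hS]
    ring
  have hy : 0 < S / (2 * β + 2 * r - 2) := div_pos hSp hs2
  intro t₁
  have ht : t₁ = (((-β ^ 2 - β * r + 2 * β + 2 * r - 2) / (2 * β + 2 * r - 2) : ℝ) : ℂ)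
      + ((S / (2 * β + 2 * r - 2) : ℝ) : ℂ) * Complex.I := by
    simp only [t₁, Complex.ofReal_div]
    ring
  rw [ht]
  generalize (-β ^ 2 - β * r + 2 * β + 2 * r - 2) / (2 * β + 2 * r - 2) = x at hxy
  generalize S / (2 * β + 2 * r - 2) = y at hxy hy
  refine ⟨?_, ?_, ?_⟩
  · have h : (x : ℂ) ^ 2 + (y : ℂ) ^ 2 = 1 := by exact_mod_cast hxy
    push_cast
    linear_combination (y : ℂ) ^ 2 * Complex.I_sq - h
  · rw [Complex.norm_add_mul_I, hxy, Real.sqrt_one]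
  · simpa using hy.ne'
end

section
/- Fix 0 < β < 1 and Ψ₁ < r < 1, where Ψ₁ := (β² − 4β + 4)/(4 − β), and define m : ℝ → ℝ by m(α) := √((−β³ + (α−2r)β² − (r−1)(r−α+1)β + r)/(β+r)). Then m has derivative β(β+r−1)/(2(β+r)) at the point α = Ψ₃ := (β² + 2rβ + r²)/(r + β − 1), and this derivative is strictly positive (the transversality condition for the Neimark–Sacker bifurcation). -/
theorem sir_NS_transversality (β r : ℝ)
    (hβ0 : 0 < β) (hβ1 : β < 1)
    (hr0 : (β ^ 2 - 4 * β + 4) / (4 - β) < r) (hr1 : r < 1) :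
    HasDerivAt
      (fun α : ℝ =>
        Real.sqrt ((-β ^ 3 + (α - 2 * r) * β ^ 2 - (r - 1) * (r - α + 1) * β + r) / (β + r)))
      (β * (β + r - 1) / (2 * (β + r)))
      ((β ^ 2 + 2 * r * β + r ^ 2) / (r + β - 1)) ∧
    0 < β * (β + r - 1) / (2 * (β + r)) := by
  have h4 : 0 < 4 - β := by linarith
  have hs : 0 < β + r - 1 := by
    rw [div_lt_iff₀ h4] at hr0
    by_contra h
    have h' : r ≤ 1 - β := by linarith
    nlinarith [mul_le_mul_of_nonneg_right h' h4.le]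
  have hp : 0 < β + r := by linarith
  refine ⟨?_, by positivity⟩
  have hfun : (fun α : ℝ =>
      Real.sqrt ((-β ^ 3 + (α - 2 * r) * β ^ 2 - (r - 1) * (r - α + 1) * β + r) / (β + r)))
      = fun α : ℝ => Real.sqrt ((α * (β * (β + r - 1))
        + (-β ^ 3 - 2 * r * β ^ 2 - (r ^ 2 - 1) * β + r)) / (β + r)) := by
    funext α
    congr 2
    ring
  rw [hfun]
  have hs2 : r + β - 1 ≠ 0 := by
    intro h
    linarith
  have hval : ((β ^ 2 + 2 * r * β + r ^ 2) / (r + β - 1) * (β * (β + r - 1))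
        + (-β ^ 3 - 2 * r * β ^ 2 - (r ^ 2 - 1) * β + r)) / (β + r) = 1 := by
    have e : (β ^ 2 + 2 * r * β + r ^ 2) / (r + β - 1) * (β * (β + r - 1))
        = (β ^ 2 + 2 * r * β + r ^ 2) * β := by
      rw [show β + r - 1 = r + β - 1 by ring, mul_comm β, ← mul_assoc, div_mul_cancel₀ _ hs2]
    rw [e, div_eq_one_iff_eq hp.ne']
    ring
  have hd := ((((hasDerivAt_id ((β ^ 2 + 2 * r * β + r ^ 2) / (r + β - 1))).mul_const
    (β * (β + r - 1))).add_const
      (-β ^ 3 - 2 * r * β ^ 2 - (r ^ 2 - 1) * β + r)).div_const (β + r)).sqrt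
    (by simp only [id]; rw [hval]; exact one_ne_zero)
  simp only [id] at hd
  rw [hval] at hd
  convert hd using 1
  rw [Real.sqrt_one]
  field_simp
end

section
/- Define 𝔄 := −((β² + βr − 1)(β + r)⁴)/(8N²(β + r − 1)) and Ψ₁ := (β² − 4β + 4)/(4 − β). (i) If N > 0, 0 < β < 4/5 and Ψ₁ < r < (1 − β²)/β, then 𝔄 > 0. (ii) If N > 0, 4/5 ≤ β < 1 and Ψ₁ < r < 1, then 𝔄 < 0. -/
theorem sir_first_lyapunov_sign (N β r : ℝ) :
    (0 < N → 0 < β → β < 4 / 5 → (β ^ 2 - 4 * β + 4) / (4 - β) < r →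
      r < (1 - β ^ 2) / β →
      0 < -((β ^ 2 + β * r - 1) * (β + r) ^ 4) / (8 * N ^ 2 * (β + r - 1))) ∧
    (0 < N → 4 / 5 ≤ β → β < 1 → (β ^ 2 - 4 * β + 4) / (4 - β) < r → r < 1 →
      -((β ^ 2 + β * r - 1) * (β + r) ^ 4) / (8 * N ^ 2 * (β + r - 1)) < 0) := by
  have key : 0 < β → β < 1 → (β ^ 2 - 4 * β + 4) / (4 - β) < r →
      4 < (β + r) * (4 - β) ∧ 0 < β + r - 1 := by
    intro h0 h1 h
    have h4 : 0 < 4 - β := by linarith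
    rw [div_lt_iff₀ h4] at h
    have h5 : 4 < (β + r) * (4 - β) := by nlinarith
    refine ⟨h5, ?_⟩
    by_contra hc
    have : (β + r) * (4 - β) ≤ 1 * (4 - β) :=
      mul_le_mul_of_nonneg_right (by linarith) h4.le
    linarith
  constructor
  · intro hN h0 h1 h h2
    obtain ⟨_, h6⟩ := key h0 (by linarith) h
    rw [lt_div_iff₀ h0] at h2
    have h7 : 0 < (β + r) ^ 4 := pow_pos (by linarith) 4
    have h8 : (β ^ 2 + β * r - 1) * (β + r) ^ 4 < 0 :=
      mul_neg_of_neg_of_pos (by linarith) h7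
    exact div_pos (by linarith) (by positivity)
  · intro hN h0 h1 h h2
    obtain ⟨h5, h6⟩ := key (by linarith) h1 h
    have h7 : 0 < (β + r) ^ 4 := pow_pos (by linarith) 4
    have h9 : (β + r) * (4 - β) ≤ (β + r) * (4 * β) :=
      mul_le_mul_of_nonneg_left (by linarith) (by linarith)
    have h8 : 0 < (β ^ 2 + β * r - 1) * (β + r) ^ 4 :=
      mul_pos (by nlinarith) h7
    exact div_neg_of_neg_of_pos (by linarith) (by positivity)
end

section
/- Let β ≠ 0 and θ ∈ ℝ with cos θ ≠ 1 and β + 2cos θ − 2 ≠ 0, and set r* := −(β² + 2β cos θ − 2β − 2cos θ + 2)/(β + 2cos θ − 2) and α* := −4(cos θ − 1)²/(β(β + 2cos θ − 2)). Then β + r* ≠ 0, and with r = r*, α = α* one has b = 2cos θ and c = −1; consequently the complex number e^{iθ} = cos θ + i sin θ satisfies (e^{iθ})² − b·e^{iθ} − c = 0, i.e. e^{±iθ} are eigenvalues of the Jacobian of the SIR map at E₂. In particular, θ = 2π/3 yields the 1:3 resonance values r* = −(β² − 3β + 3)/(β − 3), α* = −9/(β(β − 3)), and θ = π/2 yields the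 1:4 resonance values r* = −(β² − 2β + 2)/(β − 2), α* = −4/(β(β − 2)). -/
theorem sir_resonance_eigenvalues (β θ rs αs : ℝ)
    (hβ : β ≠ 0) (hc : Real.cos θ ≠ 1) (hd : β + 2 * Real.cos θ - 2 ≠ 0)
    (hrs : rs = -(β ^ 2 + 2 * β * Real.cos θ - 2 * β - 2 * Real.cos θ + 2)
        / (β + 2 * Real.cos θ - 2))
    (hαs : αs = -(4 * (Real.cos θ - 1) ^ 2) / (β * (β + 2 * Real.cos θ - 2))) :
    β + rs ≠ 0 ∧
    ((2 - αs) * β + 2 * rs) / (β + rs) = 2 * Real.cos θ ∧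
    (β ^ 3 + (-αs + 2 * rs) * β ^ 2 + (rs - 1) * (rs - αs + 1) * β - rs) / (β + rs) = -1 ∧
    (Complex.exp (θ * Complex.I)) ^ 2
      - (((((2 - αs) * β + 2 * rs) / (β + rs) : ℝ)) : ℂ) * Complex.exp (θ * Complex.I)
      - ((((β ^ 3 + (-αs + 2 * rs) * β ^ 2 + (rs - 1) * (rs - αs + 1) * β - rs)
            / (β + rs) : ℝ)) : ℂ) = 0 ∧
    (θ = 2 * Real.pi / 3 →
      rs = -(β ^ 2 - 3 * β + 3) / (β - 3) ∧ αs = -9 / (β * (β - 3))) ∧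
    (θ = Real.pi / 2 →
      rs = -(β ^ 2 - 2 * β + 2) / (β - 2) ∧ αs = -4 / (β * (β - 2))) := by
  have h1 : β + rs = 2 * (Real.cos θ - 1) / (β + 2 * Real.cos θ - 2) := by
    rw [hrs, eq_div_iff hd, add_mul, div_mul_cancel₀ _ hd]; ring
  have hc' : Real.cos θ - 1 ≠ 0 := sub_ne_zero.mpr hc
  have h0 : β + rs ≠ 0 := by
    rw [h1]; exact div_ne_zero (mul_ne_zero two_ne_zero hc') hd
  have hαβ : αs * β = -(β + rs) * (2 * (Real.cos θ - 1)) := by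
    rw [h1, hαs]; field_simp; ring
  have hq : (β + rs) ^ 2 - αs * (β + rs) + αs = 0 := by
    rw [h1, hαs]
    generalize Real.cos θ = C at *
    obtain ⟨d, hdd⟩ : ∃ d, d = β + 2 * C - 2 := ⟨_, rfl⟩
    rw [← hdd] at hd ⊢
    field_simp
    rw [hdd]; ring
  have hb : ((2 - αs) * β + 2 * rs) / (β + rs) = 2 * Real.cos θ := by
    rw [div_eq_iff h0]; linear_combination -hαβ
  have hcc : (β ^ 3 + (-αs + 2 * rs) * β ^ 2 + (rs - 1) * (rs - αs + 1) * β - rs) / (β + rs)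
      = -1 := by
    rw [div_eq_iff h0]; linear_combination β * hq
  refine ⟨h0, hb, hcc, ?_, ?_, ?_⟩
  · rw [hb, hcc, Complex.exp_mul_I]
    push_cast
    have := Complex.sin_sq_add_cos_sq (θ : ℂ)
    linear_combination Complex.sin (θ : ℂ) ^ 2 * Complex.I_sq - this
  · intro h
    have hC : Real.cos θ = -1 / 2 := by
      rw [h, show 2 * Real.pi / 3 = Real.pi - Real.pi / 3 by ring, Real.cos_pi_sub,
        Real.cos_pi_div_three]; norm_num
    rw [hC] at hrs hαs
    rw [hrs, hαs]
    constructor <;> congr 1 <;> ring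
  · intro h
    have hC : Real.cos θ = 0 := by rw [h, Real.cos_pi_div_two]
    rw [hC] at hrs hαs
    rw [hrs, hαs]
    constructor <;> congr 1 <;> ring
end
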